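/- For any real number s > -3 and any δ > 0, there exists a constant C > 0 such that for all v ∈ ℝ³, the integral ∫_{ℝ³} |v - w|^s e^{-δ|w|²} dw ≤ C (1 + |v|²)^{s/2}. -/

import Mathlib

open MeasureTheory Real

lemma integrable_norm_rpow_mul_exp_neg_mul_sq {s b : ℝ} (hs : -3 < s) (hb : 0 < b) :
    Integrable fun w : EuclideanSpace ℝ (Fin 3) => ‖w‖ ^ s * Real.exp (-b * ‖w‖ ^ 2) := by
  refine (integrable_fun_norm_addHaar (E := EuclideanSpace ℝ (Fin 3)) volume
    (f := fun r : ℝ => r ^ s * Real.exp (-b * r ^ 2))).2 ?_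
  have h := integrableOn_rpow_mul_exp_neg_mul_sq hb (s := s + 2) (by linarith)
  refine h.congr_fun (fun r hr => ?_) measurableSet_Ioi
  have hr' : (0 : ℝ) < r := hr
  simp [Real.rpow_add hr']
  ring

lemma exists_one_add_rpow_le_mul_exp {a b : ℝ} (ha : 0 ≤ a) (hb : 0 < b) :
    ∃ G > 0, ∀ x : ℝ, 0 ≤ x → (1 + x) ^ a ≤ G * Real.exp (b * x) := by
  have hc : 0 < b / (a + 1) := by positivity
  set c := b / (a + 1) with hcdef
  refine ⟨(1 + 1 / c) ^ a, by positivity, fun x hx => ?_⟩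
  have h1 : 1 + x ≤ (1 + 1 / c) * Real.exp (c * x) := by
    have h2 : 1 + x ≤ (1 + 1 / c) * (c * x + 1) := by
      have : (1 + 1 / c) * (c * x + 1) = 1 + x + (c * x + 1 / c) := by field_simp; ring
      have : 0 ≤ c * x + 1 / c := by positivity
      linarith
    exact h2.trans (by gcongr; exact Real.add_one_le_exp _)
  have hca : c * a ≤ b := by
    have : c * (a + 1) = b := by rw [hcdef]; field_simp
    nlinarith
  calc (1 + x) ^ a ≤ ((1 + 1 / c) * Real.exp (c * x)) ^ a := by gcongr
    _ = (1 + 1 / c) ^ a * Real.exp (c * a * x) := by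
      rw [Real.mul_rpow (by positivity) (by positivity), ← Real.exp_mul]; ring_nf
    _ ≤ _ := by gcongr

lemma rpow_le_rpow_mul_rpow_abs {x y z t : ℝ} (hx : 0 < x) (hy : 0 < y) (hz : 0 ≤ z)
    (hxy : x ≤ y * z) (hyx : y ≤ x * z) : x ^ t ≤ y ^ t * z ^ |t| := by
  rcases le_total 0 t with ht | ht
  · rw [abs_of_nonneg ht, ← Real.mul_rpow hy.le hz]
    gcongr
  · have h : y ^ (-t) ≤ x ^ (-t) * z ^ (-t) := by
      rw [← Real.mul_rpow hx.le hz]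
      exact Real.rpow_le_rpow hy.le hyx (by linarith)
    rw [abs_of_nonpos ht]
    calc x ^ t = x ^ t * y ^ t * y ^ (-t) := by
          rw [mul_assoc, ← Real.rpow_add hy]; simp
      _ ≤ x ^ t * y ^ t * (x ^ (-t) * z ^ (-t)) := by gcongr
      _ = (x ^ t * x ^ (-t)) * (y ^ t * z ^ (-t)) := by ring
      _ = _ := by rw [← Real.rpow_add hx]; simp

lemma one_add_norm_add_sq_le {E : Type*} [SeminormedAddCommGroup E] (x y : E) :
    1 + ‖x + y‖ ^ 2 ≤ (1 + ‖x‖ ^ 2) * (2 * (1 + ‖y‖ ^ 2)) := by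
  have h : ‖x + y‖ ^ 2 ≤ (‖x‖ + ‖y‖) ^ 2 := by gcongr; exact norm_add_le x y
  nlinarith [sq_nonneg (‖x‖ - ‖y‖), sq_nonneg (‖x‖ * ‖y‖)]

lemma rpow_le_mul_one_add_sq_rpow {r : ℝ} (hr : 0 ≤ r) (s : ℝ) :
    r ^ s ≤ (1 + r ^ 2) ^ (s / 2) *
      (2 ^ |s / 2| * (1 + r ^ s * (Real.exp 1 * Real.exp (-1 * r ^ 2)))) := by
  have hsq : (r ^ 2) ^ (s / 2) = r ^ s := by
    rw [← Real.rpow_natCast, ← Real.rpow_mul hr]; congr 1; push_cast; ring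
  have h2 : (1 : ℝ) ≤ 2 ^ |s / 2| := Real.one_le_rpow (by norm_num) (abs_nonneg _)
  have hp : 0 ≤ r ^ s := by positivity
  rcases le_total 1 r with h | h
  · have hle : r ^ s ≤ (1 + r ^ 2) ^ (s / 2) * 2 ^ |s / 2| := by
      rw [← hsq]
      exact rpow_le_rpow_mul_rpow_abs (by positivity) (by positivity) (by norm_num)
        (by nlinarith) (by nlinarith)
    refine hle.trans ?_
    gcongr
    exact le_mul_of_one_le_right (by positivity) (le_add_of_nonneg_right (by positivity))
  · have h1 : 1 ≤ (1 + r ^ 2) ^ (s / 2) * 2 ^ |s / 2| := by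
      simpa using rpow_le_rpow_mul_rpow_abs (x := 1) (y := 1 + r ^ 2) (z := 2) (t := s / 2)
        (by norm_num) (by positivity) (by norm_num) (by nlinarith) (by nlinarith)
    have he : 1 ≤ Real.exp 1 * Real.exp (-1 * r ^ 2) := by
      rw [← Real.exp_add]; exact Real.one_le_exp (by nlinarith)
    rw [← mul_assoc]
    calc r ^ s = 1 * (r ^ s * 1) := by ring
      _ ≤ _ := by
        refine mul_le_mul h1 ?_ (by positivity) (by positivity)
        have := mul_le_mul_of_nonneg_left he hp
        linarith

theorem landau_convolution_weight_bound (s : ℝ) (hs : s > -3) (δ : ℝ) (hδ : δ > 0) :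
    ∃ C > 0, ∀ v : EuclideanSpace ℝ (Fin 3),
      ∫ w : EuclideanSpace ℝ (Fin 3), ‖v - w‖ ^ s * Real.exp (-δ * ‖w‖ ^ 2)
        ≤ C * (1 + ‖v‖ ^ 2) ^ (s / 2) := by
  obtain ⟨G, hG, hGb⟩ := exists_one_add_rpow_le_mul_exp (abs_nonneg (s / 2)) (half_pos hδ)
  have hI := integrable_norm_rpow_mul_exp_neg_mul_sq (s := 0) (by norm_num) (half_pos hδ)
  have hJ := integrable_norm_rpow_mul_exp_neg_mul_sq hs one_pos
  simp only [Real.rpow_zero, one_mul] at hI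
  set f := fun w : EuclideanSpace ℝ (Fin 3) => Real.exp (-(δ / 2) * ‖w‖ ^ 2) with hf
  set g := fun u : EuclideanSpace ℝ (Fin 3) => ‖u‖ ^ s * Real.exp (-1 * ‖u‖ ^ 2) with hg
  have hI0 : 0 ≤ ∫ w, f w := integral_nonneg fun w => (Real.exp_pos _).le
  have hJ0 : 0 ≤ ∫ w, g w := integral_nonneg fun w => by simp only [hg, Pi.zero_apply]; positivity
  set K : ℝ := 2 ^ |s / 2| * 2 ^ |s / 2| * G with hK
  have hK0 : 0 < K := by positivity
  refine ⟨K * ((∫ w, f w) + Real.exp 1 * ∫ w, g w) + 1, by positivity, fun v => ?_⟩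
  set V := (1 + ‖v‖ ^ 2) ^ (s / 2) with hV
  have hV0 : 0 ≤ V := by positivity
  have hJv : Integrable fun w => g (v - w) := hJ.comp_sub_left v
  have key : ∀ w : EuclideanSpace ℝ (Fin 3), ‖v - w‖ ^ s * Real.exp (-δ * ‖w‖ ^ 2)
      ≤ K * V * (f w + Real.exp 1 * g (v - w)) := by
    intro w
    have hA := rpow_le_mul_one_add_sq_rpow (norm_nonneg (v - w)) s
    have hP : (1 + ‖v - w‖ ^ 2) ^ (s / 2) ≤ V * (2 * (1 + ‖w‖ ^ 2)) ^ |s / 2| := by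
      refine rpow_le_rpow_mul_rpow_abs (by positivity) (by positivity) (by positivity) ?_ ?_
      · simpa [sub_eq_add_neg] using one_add_norm_add_sq_le v (-w)
      · simpa using one_add_norm_add_sq_le (v - w) w
    rw [Real.mul_rpow (by norm_num) (by positivity)] at hP
    have hW := hGb (‖w‖ ^ 2) (by positivity)
    have hg0 : 0 ≤ g (v - w) := by simp only [hg]; positivity
    have hf0 : 0 ≤ f w := (Real.exp_pos _).le
    have hf1 : f w ≤ 1 := Real.exp_le_one_iff.2 (by
      have : 0 ≤ δ / 2 * ‖w‖ ^ 2 := by positivity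
      linarith)
    have hexp : Real.exp (δ / 2 * ‖w‖ ^ 2) * Real.exp (-δ * ‖w‖ ^ 2) = f w := by
      rw [hf, ← Real.exp_add]; congr 1; ring
    have hge : ‖v - w‖ ^ s * (Real.exp 1 * Real.exp (-1 * ‖v - w‖ ^ 2))
        = Real.exp 1 * g (v - w) := by simp only [hg]; ring
    rw [hge] at hA
    calc ‖v - w‖ ^ s * Real.exp (-δ * ‖w‖ ^ 2)
        ≤ V * (2 ^ |s / 2| * (G * Real.exp (δ / 2 * ‖w‖ ^ 2))) *
          (2 ^ |s / 2| * (1 + Real.exp 1 * g (v - w))) * Real.exp (-δ * ‖w‖ ^ 2) := by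
          gcongr
          refine hA.trans ?_
          gcongr
          refine hP.trans ?_
          gcongr
      _ = K * V * ((1 + Real.exp 1 * g (v - w)) *
          (Real.exp (δ / 2 * ‖w‖ ^ 2) * Real.exp (-δ * ‖w‖ ^ 2))) := by rw [hK]; ring
      _ = K * V * (f w + Real.exp 1 * g (v - w) * f w) := by rw [hexp]; ring
      _ ≤ _ := by
          gcongr K * V * (f w + ?_)
          exact mul_le_of_le_one_right (by positivity) hf1
  calc ∫ w, ‖v - w‖ ^ s * Real.exp (-δ * ‖w‖ ^ 2)
      ≤ ∫ w, K * V * (f w + Real.exp 1 * g (v - w)) := by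
        refine integral_mono_of_nonneg (.of_forall fun w => ?_)
          ((hI.add (hJv.const_mul _)).const_mul _) (.of_forall key)
        simp only [Pi.zero_apply]; positivity
    _ = K * V * ((∫ w, f w) + Real.exp 1 * ∫ w, g w) := by
        rw [integral_const_mul, integral_add hI (hJv.const_mul _), integral_const_mul,
          integral_sub_left_eq_self g volume v]
    _ ≤ _ := by nlinarith
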